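/- A holomorphic motion h : Δ_r × E → Ĉ of a set E ⊂ Ĉ is jointly continuous on Δ_r × E (continuity in z is a consequence of the definition, which only imposes regularity in the parameter c). -/

import Mathlib

open Metric Complex

/-- A holomorphic motion of a set `E ⊆ ℂ` parametrized by the disk of radius `r`. -/
def IsHolomorphicMotion (r : ℝ) (E : Set ℂ) (h : ℂ → ℂ → ℂ) : Prop :=
  (∀ z ∈ E, h 0 z = z) ∧
  (∀ c ∈ ball (0:ℂ) r, Set.InjOn (h c) E) ∧
  (∀ z ∈ E, DifferentiableOn ℂ (fun c => h c z) (ball (0:ℂ) r))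

/-- A nonvanishing holomorphic function on a disk centred at the origin has a logarithm with any
admissible value at the origin. -/
theorem exists_differentiableOn_exp_eq {r : ℝ} (hr : 0 < r) {f : ℂ → ℂ}
    (hf : DifferentiableOn ℂ f (ball 0 r)) (hf0 : ∀ z ∈ ball (0 : ℂ) r, f z ≠ 0)
    {w : ℂ} (hw : exp w = f 0) :
    ∃ g : ℂ → ℂ, DifferentiableOn ℂ g (ball 0 r) ∧ g 0 = w ∧
      ∀ z ∈ ball (0 : ℂ) r, exp (g z) = f z := by
  have hdiv : DifferentiableOn ℂ (fun z => deriv f z / f z) (ball 0 r) :=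
    (hf.deriv isOpen_ball).div hf hf0
  obtain ⟨g, hg0, hg⟩ := hdiv.isExactOn_ball.with_val_at 0 w
  refine ⟨g, fun z hz => (hg z hz).differentiableAt.differentiableWithinAt, hg0, ?_⟩
  have hder : ∀ z ∈ ball (0 : ℂ) r, HasDerivAt (fun z => f z * exp (-g z)) 0 z := fun z hz => by
    have h1 : HasDerivAt f (deriv f z) z :=
      (hf.differentiableAt (isOpen_ball.mem_nhds hz)).hasDerivAt
    convert! h1.mul (hg z hz).neg.cexp using 1
    field_simp [hf0 z hz]
    ring
  intro z hz
  have hconst : f z * exp (-g z) = f 0 * exp (-g 0) :=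
    isOpen_ball.is_const_of_deriv_eq_zero (convex_ball (0 : ℂ) r).isPreconnected
      (fun z hz => (hder z hz).differentiableAt.differentiableWithinAt)
      (fun z hz => (hder z hz).deriv) hz (mem_ball_self hr)
  rw [hg0, ← hw, ← exp_add, add_neg_cancel, exp_zero, exp_neg] at hconst
  field_simp [exp_ne_zero] at hconst
  exact hconst.symm

/-- A holomorphic function whose derivative on a disk is at most twice its derivative at the
centre covers a definite disk. -/
theorem ball_subset_image_closedBall_of_norm_deriv_le {f : ℂ → ℂ} {a : ℂ} {ρ : ℝ} (hρ : 0 < ρ)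
    (hf : DifferentiableOn ℂ f (ball a ρ)) (ha : deriv f a ≠ 0)
    (hb : ∀ z ∈ ball a ρ, ‖deriv f z‖ ≤ 2 * ‖deriv f a‖) :
    ball (f a) (‖deriv f a‖ * ρ / 24) ⊆ f '' closedBall a (ρ / 6) := by
  have hsub : closedBall a (ρ / 6) ⊆ ball a ρ := closedBall_subset_ball (by linarith)
  have hdiff : ∀ z ∈ ball a ρ, DifferentiableAt ℂ f z := fun z hz =>
    hf.differentiableAt (isOpen_ball.mem_nhds hz)
  have hderiv : ∀ z ∈ closedBall a (ρ / 6), ‖deriv f z - deriv f a‖ ≤ ‖deriv f a‖ / 2 := by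
    intro z hz
    have h1 := dist_le_div_mul_dist_of_mapsTo_ball (R₂ := 3 * ‖deriv f a‖)
      (hf.deriv isOpen_ball) (fun x hx => by
        rw [mem_closedBall, dist_eq_norm]
        linarith [norm_sub_le (deriv f x) (deriv f a), hb x hx]) (hsub hz)
    rw [dist_eq_norm] at h1
    refine h1.trans ?_
    calc 3 * ‖deriv f a‖ / ρ * dist z a ≤ 3 * ‖deriv f a‖ / ρ * (ρ / 6) := by
          gcongr; exact hz
      _ = ‖deriv f a‖ / 2 := by field_simp; norm_num
  have hF : ∀ z ∈ closedBall a (ρ / 6),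
      ‖(f z - deriv f a * z) - (f a - deriv f a * a)‖ ≤ ‖deriv f a‖ / 2 * ‖z - a‖ := by
    intro z hz
    refine (convex_closedBall a (ρ / 6)).norm_image_sub_le_of_norm_hasDerivWithin_le
      (f := fun z => f z - deriv f a * z) (f' := fun z => deriv f z - deriv f a)
      (fun x hx => ?_) hderiv (mem_closedBall_self (by positivity)) hz
    convert! ((hdiff x (hsub hx)).hasDerivAt.sub
      ((hasDerivAt_id x).const_mul (deriv f a))).hasDerivWithinAt using 1
    rw [mul_one]
  have hρ6 : ρ / 6 ≠ 0 := by positivity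
  have key := DiffContOnCl.ball_subset_image_closedBall (f := f) (z₀ := a) (r := ρ / 6)
    (ε := ‖deriv f a‖ * ρ / 12) ?_ (by positivity) ?_ ?_
  · convert key using 2; ring
  · refine DifferentiableOn.diffContOnCl ?_
    rw [closure_ball a hρ6]
    exact hf.mono hsub
  · intro z hz
    have hz' : ‖z - a‖ = ρ / 6 := by rwa [mem_sphere, dist_eq_norm] at hz
    have h1 := hF z (sphere_subset_closedBall hz)
    have h2 : ‖deriv f a * (z - a)‖ ≤ ‖f z - f a‖ +
        ‖(f z - deriv f a * z) - (f a - deriv f a * a)‖ := by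
      refine le_trans (le_of_eq ?_)
        (norm_sub_le (f z - f a) ((f z - deriv f a * z) - (f a - deriv f a * a)))
      congr 1; ring
    rw [norm_mul, hz'] at h2
    rw [hz'] at h1
    linarith
  · have := (hdiff a (mem_ball_self hρ)).hasDerivAt.eventually_ne (c := f a) ha
    exact (this.frequently).filter_mono nhdsWithin_le_nhds

/-- **Bloch's theorem**, with constant `1 / 48`. -/
theorem exists_ball_subset_image_closedBall {f : ℂ → ℂ} {a : ℂ} {ρ : ℝ} (hρ : 0 < ρ)
    {U : Set ℂ} (hU : IsOpen U) (hf : DifferentiableOn ℂ f U) (hsub : closedBall a ρ ⊆ U) :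
    ∃ w, ball w (‖deriv f a‖ * ρ / 48) ⊆ f '' closedBall a ρ := by
  rcases eq_or_ne (deriv f a) 0 with ha | ha
  · exact ⟨0, by simp [ha]⟩
  have hcont : ContinuousOn (fun z => ‖deriv f z‖ * (ρ - dist z a)) (closedBall a ρ) :=
    ((hf.deriv hU).continuousOn.mono hsub).norm.mul (by fun_prop)
  obtain ⟨b, hb, hmax⟩ := (isCompact_closedBall a ρ).exists_isMaxOn
    ⟨a, mem_closedBall_self hρ.le⟩ hcont
  have hab : ‖deriv f a‖ * ρ ≤ ‖deriv f b‖ * (ρ - dist b a) := by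
    simpa using hmax (mem_closedBall_self hρ.le)
  have hpos : 0 < ‖deriv f b‖ * (ρ - dist b a) :=
    (mul_pos (norm_pos_iff.2 ha) hρ).trans_le hab
  have ht : 0 < ρ - dist b a := pos_of_mul_pos_right hpos (norm_nonneg _)
  have hb0 : deriv f b ≠ 0 := by
    intro h0
    simp [h0] at hpos
  have hball : ball b ((ρ - dist b a) / 2) ⊆ closedBall a ρ := fun z hz => by
    rw [mem_ball] at hz
    rw [mem_closedBall]
    linarith [dist_triangle z b a]
  have hcover := ball_subset_image_closedBall_of_norm_deriv_le (f := f) (half_pos ht)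
    (hf.mono (hball.trans hsub)) hb0 (fun z hz => by
      have h1 : ‖deriv f z‖ * (ρ - dist z a) ≤ ‖deriv f b‖ * (ρ - dist b a) := hmax (hball hz)
      rw [mem_ball] at hz
      have h2 : (ρ - dist b a) / 2 ≤ ρ - dist z a := by linarith [dist_triangle z b a]
      have h3 := mul_le_mul_of_nonneg_left h2 (norm_nonneg (deriv f z))
      refine le_of_mul_le_mul_right ?_ (half_pos ht)
      linarith)
  refine ⟨f b, (ball_subset_ball ?_).trans (hcover.trans (Set.image_mono ?_))⟩
  · linarith
  · exact (closedBall_subset_ball (by linarith)).trans hball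

theorem exists_nat_sinh_sq_eq (x : ℝ) : ∃ (q : ℝ) (n : ℕ), |q - x| ≤ 1 ∧ Real.sinh q ^ 2 = n := by
  wlog hx : 0 ≤ x
  · obtain ⟨q, n, hq, hn⟩ := this (-x) (by linarith)
    refine ⟨-q, n, ?_, by simpa using hn⟩
    rwa [← abs_neg, show -(-q - x) = q - -x by ring]
  set n := ⌈Real.sinh x ^ 2⌉₊
  have hs : 0 ≤ Real.sinh x := Real.sinh_nonneg_iff.2 hx
  have h1 : Real.sinh x ≤ √n := Real.le_sqrt_of_sq_le (Nat.le_ceil _)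
  have h2 : √n ≤ Real.sinh (x + 1) := by
    have hn : (n : ℝ) ≤ Real.sinh x ^ 2 + 1 := (Nat.ceil_lt_add_one (sq_nonneg _)).le
    have hone : 1 ≤ Real.sinh 1 := Real.self_le_sinh_iff.2 zero_le_one
    have hadd : Real.sinh x + 1 ≤ Real.sinh (x + 1) := by
      rw [Real.sinh_add]
      nlinarith [Real.one_le_cosh x, Real.one_le_cosh 1]
    refine (Real.sqrt_le_iff.2 ⟨by positivity, ?_⟩).trans hadd
    nlinarith
  refine ⟨Real.arsinh √n, n, ?_, ?_⟩
  · have h3 := Real.arsinh_le_arsinh.2 h1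
    have h4 := Real.arsinh_le_arsinh.2 h2
    rw [Real.arsinh_sinh] at h3 h4
    rw [abs_le]
    constructor <;> linarith
  · rw [Real.sinh_arsinh, Real.sq_sqrt (Nat.cast_nonneg n)]

/-- The points at which `cosh ^ 2` takes an integer value meet every disk of radius `2`. -/
theorem exists_mem_ball_cosh_sq_eq_intCast (w : ℂ) :
    ∃ p ∈ ball w 2, ∃ n : ℤ, cosh p ^ 2 = n := by
  obtain ⟨q, n, hq, hn⟩ := exists_nat_sinh_sq_eq w.re
  set k : ℤ := round (w.im / (Real.pi / 2)) with hk
  have hpi := Real.pi_pos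
  have him : |k * (Real.pi / 2) - w.im| ≤ Real.pi / 4 := by
    have h1 := abs_sub_round (w.im / (Real.pi / 2))
    rw [← hk] at h1
    calc |k * (Real.pi / 2) - w.im| = |w.im / (Real.pi / 2) - k| * (Real.pi / 2) := by
          rw [← abs_of_pos (half_pos hpi), ← abs_mul, abs_of_pos (half_pos hpi), ← abs_neg]
          congr 1; field_simp; ring
      _ ≤ 1 / 2 * (Real.pi / 2) := by gcongr
      _ = Real.pi / 4 := by ring
  refine ⟨⟨q, k * (Real.pi / 2)⟩, ?_, ?_⟩
  · rw [mem_ball, dist_eq_norm]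
    refine (norm_le_abs_re_add_abs_im _).trans_lt ?_
    simp only [sub_re, sub_im]
    linarith [Real.pi_lt_four]
  · have hsinh : sinh (q : ℂ) ^ 2 = n := by exact_mod_cast congrArg (fun x : ℝ => (x : ℂ)) hn
    have hp : (⟨q, k * (Real.pi / 2)⟩ : ℂ) = q + (k * (Real.pi / 2) : ℂ) * I := by
      apply Complex.ext <;> simp
    have hcs := cosh_sq (q : ℂ)
    have hcs' := sin_sq_add_cos_sq (k * (Real.pi / 2) : ℂ)
    have hzero : sin (k * (Real.pi / 2) : ℂ) * cos (k * (Real.pi / 2) : ℂ) = 0 := by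
      have h2 := sin_two_mul (k * (Real.pi / 2) : ℂ)
      rw [show 2 * (k * (Real.pi / 2) : ℂ) = k * Real.pi by ring, sin_int_mul_pi] at h2
      linear_combination -h2 / 2
    rw [hp, cosh_add, cosh_mul_I, sinh_mul_I]
    rcases mul_eq_zero.1 hzero with h0 | h0
    · refine ⟨n + 1, ?_⟩
      rw [h0] at hcs' ⊢
      push_cast
      linear_combination (cosh (q : ℂ)) ^ 2 * hcs' + hcs + hsinh
    · refine ⟨-n, ?_⟩
      rw [h0] at hcs' ⊢
      push_cast
      linear_combination -(sinh (q : ℂ)) ^ 2 * hcs' - hsinh +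
        (sinh (q : ℂ)) ^ 2 * sin (k * (Real.pi / 2) : ℂ) ^ 2 * I_sq

/-- A holomorphic function on a disk omitting all points where `cosh ^ 2` is an integer has
controlled oscillation on smaller disks. -/
theorem norm_sub_le_of_cosh_sq_ne_intCast {r ρ : ℝ} (hρ : 0 ≤ ρ) (hρr : ρ < r) {H : ℂ → ℂ}
    (hH : DifferentiableOn ℂ H (ball 0 r))
    (hom : ∀ z ∈ ball (0 : ℂ) r, ∀ n : ℤ, cosh (H z) ^ 2 ≠ n) {z : ℂ} (hz : z ∈ closedBall 0 ρ) :
    ‖H z - H 0‖ ≤ 192 / (r - ρ) * ρ := by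
  have hsub : closedBall (0 : ℂ) ρ ⊆ ball 0 r := closedBall_subset_ball hρr
  have hderiv : ∀ x ∈ closedBall (0 : ℂ) ρ, ‖deriv H x‖ ≤ 192 / (r - ρ) := by
    intro x hx
    have hx' : closedBall x ((r - ρ) / 2) ⊆ ball 0 r := fun y hy => by
      rw [mem_closedBall] at hx hy
      rw [mem_ball]
      linarith [dist_triangle y x 0]
    obtain ⟨w, hw⟩ := exists_ball_subset_image_closedBall (by linarith) isOpen_ball hH hx'
    by_contra! hlt
    obtain ⟨p, hp, n, hn⟩ := exists_mem_ball_cosh_sq_eq_intCast w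
    obtain ⟨y, hy, rfl⟩ := hw (ball_subset_ball (by
      rw [div_lt_iff₀ (by linarith)] at hlt
      linarith) hp)
    exact hom y (hx' hy) n hn
  have h1 := (convex_closedBall (0 : ℂ) ρ).norm_image_sub_le_of_norm_deriv_le
    (fun x hx => hH.differentiableAt (isOpen_ball.mem_nhds (hsub hx))) hderiv
    (mem_closedBall_self hρ) hz
  refine h1.trans ?_
  have : 0 < r - ρ := by linarith
  gcongr
  simpa using hz

/-- A holomorphic function on a disk omitting the integers and small at the centre is bounded on
smaller disks. -/
theorem norm_le_of_ne_intCast {r ρ : ℝ} (hρ : 0 ≤ ρ) (hρr : ρ < r) {F : ℂ → ℂ}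
    (hF : DifferentiableOn ℂ F (ball 0 r)) (hom : ∀ z ∈ ball (0 : ℂ) r, ∀ n : ℤ, F z ≠ n)
    (hF0 : ‖F 0‖ ≤ 1) {z : ℂ} (hz : z ∈ closedBall 0 ρ) :
    ‖F z‖ ≤ (3 * Real.exp (192 / (r - ρ) * ρ)) ^ 2 := by
  have hr : 0 < r := hρ.trans_lt hρr
  have hsub : closedBall (0 : ℂ) ρ ⊆ ball 0 r := closedBall_subset_ball hρr
  have hmem0 : (0 : ℂ) ∈ ball (0 : ℂ) r := mem_ball_self hr
  have sqrt_exists : ∀ g : ℂ → ℂ, DifferentiableOn ℂ g (ball 0 r) →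
      (∀ z ∈ ball (0 : ℂ) r, g z ≠ 0) →
      ∃ u : ℂ → ℂ, DifferentiableOn ℂ u (ball 0 r) ∧ ∀ z ∈ ball (0 : ℂ) r, u z ^ 2 = g z := by
    intro g hg hg0
    obtain ⟨l, hl, -, hle⟩ := exists_differentiableOn_exp_eq hr hg hg0 (exp_log (hg0 0 hmem0))
    refine ⟨fun z => exp (l z / 2), (hl.div_const 2).cexp, fun z hz => ?_⟩
    rw [← hle z hz, ← exp_nat_mul]
    congr 1; push_cast; ring
  obtain ⟨u, hu, hu2⟩ := sqrt_exists F hF (fun z hz => by simpa using hom z hz 0)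
  obtain ⟨v, hv, hv2⟩ := sqrt_exists (fun z => F z - 1) (hF.sub_const 1)
    (fun z hz => sub_ne_zero.2 (by simpa using hom z hz 1))
  have huv : ∀ z ∈ ball (0 : ℂ) r, (u z + v z) * (u z - v z) = 1 := fun z hz => by
    linear_combination hu2 z hz - hv2 z hz
  have hne : ∀ z ∈ ball (0 : ℂ) r, u z + v z ≠ 0 := fun z hz =>
    left_ne_zero_of_mul_eq_one (huv z hz)
  obtain ⟨H, hH, -, hHe⟩ := exists_differentiableOn_exp_eq hr (hu.add hv) hne
    (exp_log (hne 0 hmem0))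
  have hHe' : ∀ z ∈ ball (0 : ℂ) r, exp (-H z) = u z - v z := fun z hz => by
    rw [exp_neg, hHe z hz]
    exact inv_eq_of_mul_eq_one_right (huv z hz)
  have hcosh : ∀ z ∈ ball (0 : ℂ) r, cosh (H z) = u z := fun z hz => by
    rw [cosh, hHe' z hz, hHe z hz]
    simp only [Pi.add_apply]
    ring
  have hD := norm_sub_le_of_cosh_sq_ne_intCast hρ hρr hH
    (fun z hz n => by rw [hcosh z hz, hu2 z hz]; exact hom z hz n) hz
  have hu0 : ‖u 0‖ ≤ 1 := by
    have := congrArg norm (hu2 0 hmem0)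
    rw [norm_pow] at this
    nlinarith [norm_nonneg (u 0)]
  have hv0 : ‖v 0‖ ≤ 2 := by
    have h1 := congrArg norm (hv2 0 hmem0)
    have h2 := norm_sub_le (F 0) 1
    rw [norm_pow] at h1
    rw [norm_one] at h2
    nlinarith [norm_nonneg (v 0)]
  have hexp : ∀ (a b c : ℂ), ‖exp a‖ ≤ 3 → b = a + c → ‖c‖ ≤ 192 / (r - ρ) * ρ →
      ‖exp b‖ ≤ 3 * Real.exp (192 / (r - ρ) * ρ) := by
    rintro a _ c ha rfl hc
    rw [exp_add, norm_mul]
    gcongr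
    exact (norm_exp_le_exp_norm c).trans (Real.exp_le_exp.2 hc)
  have h1 : ‖exp (H z)‖ ≤ 3 * Real.exp (192 / (r - ρ) * ρ) :=
    hexp (H 0) _ (H z - H 0) (by
      rw [hHe 0 hmem0]; exact (norm_add_le _ _).trans (by linarith)) (by ring) hD
  have h2 : ‖exp (-H z)‖ ≤ 3 * Real.exp (192 / (r - ρ) * ρ) :=
    hexp (-H 0) _ (-(H z - H 0)) (by
      rw [hHe' 0 hmem0]; exact (norm_sub_le _ _).trans (by linarith)) (by ring)
      (by rwa [norm_neg])
  rw [← hu2 z (hsub hz), norm_pow]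
  gcongr
  rw [← hcosh z (hsub hz), cosh, norm_div, RCLike.norm_ofNat]
  linarith [norm_add_le (exp (H z)) (exp (-H z))]

/-- **Schottky's theorem** for holomorphic functions omitting `0` and `1`. -/
theorem exists_norm_le_of_ne_zero_of_ne_one {r ρ : ℝ} (hρ : 0 ≤ ρ) (hρr : ρ < r) :
    ∃ K : ℝ, ∀ f : ℂ → ℂ, DifferentiableOn ℂ f (ball 0 r) →
      (∀ z ∈ ball (0 : ℂ) r, f z ≠ 0) → (∀ z ∈ ball (0 : ℂ) r, f z ≠ 1) → ‖f 0‖ ≤ 1 / 2 →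
      ∀ z ∈ closedBall (0 : ℂ) ρ, ‖f z‖ ≤ K := by
  refine ⟨1 + Real.exp (2 * Real.pi * (3 * Real.exp (192 / (r - ρ) * ρ)) ^ 2),
    fun f hf hf0 hf1 hsmall z hz => ?_⟩
  have hr : 0 < r := hρ.trans_lt hρr
  have hmem0 : (0 : ℂ) ∈ ball (0 : ℂ) r := mem_ball_self hr
  have hne : ∀ z ∈ ball (0 : ℂ) r, 1 - f z ≠ 0 := fun z hz => sub_ne_zero.2 (hf1 z hz).symm
  obtain ⟨L, hL, hL0, hLe⟩ := exists_differentiableOn_exp_eq hr (hf.const_sub 1) hne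
    (exp_log (hne 0 hmem0))
  have hpi := Real.pi_gt_three
  have hnorm : ‖2 * Real.pi * I‖ = 2 * Real.pi := by
    simp [abs_of_pos Real.pi_pos]
  have hbound := norm_le_of_ne_intCast hρ hρr (hL.div_const (2 * Real.pi * I))
    (fun z hz n h => hf0 z hz (by
      rw [div_eq_iff two_pi_I_ne_zero] at h
      have h1 := hLe z hz
      rw [h, exp_int_mul_two_pi_mul_I] at h1
      linear_combination h1)) (by
      have h1 := norm_log_one_add_half_le_self (z := -f 0) (by rwa [norm_neg])
      rw [norm_neg, ← sub_eq_add_neg] at h1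
      rw [norm_div, hnorm, hL0, div_le_one (by positivity)]
      linarith) hz
  rw [norm_div, hnorm, div_le_iff₀ (by positivity)] at hbound
  have h1 : ‖1 - f z‖ ≤ Real.exp (2 * Real.pi * (3 * Real.exp (192 / (r - ρ) * ρ)) ^ 2) := by
    rw [← hLe z (closedBall_subset_ball hρr hz)]
    refine (norm_exp_le_exp_norm _).trans (Real.exp_le_exp.2 ?_)
    linarith
  calc ‖f z‖ = ‖1 - (1 - f z)‖ := by congr 1; ring
    _ ≤ ‖(1 : ℂ)‖ + ‖1 - f z‖ := norm_sub_le _ _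
    _ ≤ _ := by rw [norm_one]; linarith

/-- A Harnack-type bound for bounded nonvanishing holomorphic functions. -/
theorem norm_le_mul_rpow_of_ne_zero {R M : ℝ} {f : ℂ → ℂ}
    (hf : DifferentiableOn ℂ f (ball 0 R)) (hf0 : ∀ z ∈ ball (0 : ℂ) R, f z ≠ 0)
    (hM : ∀ z ∈ ball (0 : ℂ) R, ‖f z‖ ≤ M) (hlt : ‖f 0‖ < M) {z : ℂ} (hz : z ∈ ball 0 R) :
    ‖f z‖ ≤ M * (‖f 0‖ / M) ^ ((1 - (‖z‖ / R) ^ 2) / 4) := by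
  have hR : 0 < R := pos_of_mem_ball hz
  have hMpos : 0 < M := (norm_nonneg _).trans_lt hlt
  have hmem0 : (0 : ℂ) ∈ ball (0 : ℂ) R := mem_ball_self hR
  have hf00 : 0 < ‖f 0‖ := norm_pos_iff.2 (hf0 0 hmem0)
  obtain ⟨L, hL, -, hLe⟩ := exists_differentiableOn_exp_eq hR hf hf0 (exp_log (hf0 0 hmem0))
  have hre : ∀ x ∈ ball (0 : ℂ) R, (L x).re = Real.log ‖f x‖ := fun x hx => by
    rw [← hLe x hx, norm_exp, Real.log_exp]
  set N := Real.log M - Real.log ‖f 0‖ with hN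
  have hNpos : 0 < N := sub_pos.2 (Real.log_lt_log hf00 hlt)
  have hmaps : ∀ x ∈ ball (0 : ℂ) R, (L x - L 0).re ≤ N := fun x hx => by
    rw [sub_re, hre x hx, hre 0 hmem0]
    exact sub_le_sub_right (Real.log_le_log (norm_pos_iff.2 (hf0 x hx)) (hM x hx)) _
  have hx := hmaps z hz
  set g := L z - L 0 with hg
  set t := ‖z‖ / R with ht
  have ht1 : t < 1 := by
    rw [ht, div_lt_one hR]; simpa using hz
  have ht0 : 0 ≤ t := by positivity
  have hsq : ∀ w : ℂ, ‖w‖ ^ 2 = w.re ^ 2 + w.im ^ 2 := fun w => by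
    rw [Complex.sq_norm, normSq_apply]; ring
  have hnormsq : ∀ w : ℂ, ‖2 * (N : ℂ) - w‖ ^ 2 = (2 * N - w.re) ^ 2 + w.im ^ 2 := fun w => by
    rw [hsq]; simp
  have hdne : ∀ w : ℂ, w.re ≤ N → 0 < ‖2 * (N : ℂ) - w‖ := fun w hw => by
    refine norm_pos_iff.2 fun h0 => ?_
    have := congrArg re h0
    simp at this
    linarith
  have hs := dist_le_div_mul_dist_of_mapsTo_ball (R₂ := 1)
    (f := fun x => (L x - L 0) / (2 * N - (L x - L 0)))
    ((hL.sub_const (L 0)).div ((hL.sub_const (L 0)).const_sub _)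
      fun x hx => norm_pos_iff.1 (hdne _ (hmaps x hx)))
    (fun x hx => by
      have hd := hdne _ (hmaps x hx)
      have hle := hmaps x hx
      rw [sub_self, zero_div, mem_closedBall_zero_iff, norm_div, div_le_one hd]
      refine (sq_le_sq₀ (norm_nonneg _) (norm_nonneg _)).1 ?_
      rw [hnormsq, hsq]
      nlinarith) hz
  have hd := hnormsq g
  have hg2 := hsq g
  have hle : ‖g‖ ≤ t * ‖2 * (N : ℂ) - g‖ := by
    rw [sub_self, zero_div, dist_zero_right, dist_zero_right, norm_div,
      div_le_iff₀ (hdne g hx)] at hs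
    refine hs.trans_eq ?_
    rw [ht]; ring
  have hle2 : ‖g‖ ^ 2 ≤ t ^ 2 * ‖2 * (N : ℂ) - g‖ ^ 2 := by
    rw [← mul_pow]; gcongr
  have hN2 : N ^ 2 ≤ ‖2 * (N : ℂ) - g‖ ^ 2 := by
    rw [hd]; nlinarith [sq_nonneg g.im]
  have hmain : (1 - t ^ 2) / 4 * N ≤ N - g.re := by
    have h1 : 0 ≤ 1 - t ^ 2 := by nlinarith
    have h2 := mul_le_mul_of_nonneg_left hN2 h1
    refine le_of_mul_le_mul_left ?_ hNpos
    nlinarith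
  have hfz : 0 < ‖f z‖ := norm_pos_iff.2 (hf0 z hz)
  rw [hg, sub_re, hre z hz, hre 0 hmem0] at hmain
  rw [← Real.log_le_log_iff hfz (by positivity), Real.log_mul hMpos.ne' (by positivity),
    Real.log_rpow (by positivity), Real.log_div hf00.ne' hMpos.ne']
  linarith

/-- Holomorphic functions on a disk omitting `0` and `1` that are small at the centre are uniformly
small on smaller disks. -/
theorem exists_norm_lt_of_ne_zero_of_ne_one {r ρ ε : ℝ} (hρ : 0 ≤ ρ) (hρr : ρ < r) (hε : 0 < ε) :
    ∃ δ > 0, ∀ f : ℂ → ℂ, DifferentiableOn ℂ f (ball 0 r) →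
      (∀ z ∈ ball (0 : ℂ) r, f z ≠ 0) → (∀ z ∈ ball (0 : ℂ) r, f z ≠ 1) → ‖f 0‖ < δ →
      ∀ z ∈ closedBall (0 : ℂ) ρ, ‖f z‖ < ε := by
  set R := (ρ + r) / 2 with hR
  have hRpos : 0 < R := by linarith
  have hρR : ρ < R := by linarith
  have hRr : R < r := by linarith
  obtain ⟨K, hK⟩ := exists_norm_le_of_ne_zero_of_ne_one hRpos.le hRr
  set M := max K 1
  have hM1 : 1 ≤ M := le_max_right _ _
  have hMpos : 0 < M := by linarith
  set s := (1 - (ρ / R) ^ 2) / 4 with hs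
  have hspos : 0 < s := by
    have h1 : ρ / R < 1 := (div_lt_one hRpos).2 hρR
    have h2 : 0 ≤ ρ / R := by positivity
    have : 0 < 1 - (ρ / R) ^ 2 := by nlinarith
    positivity
  refine ⟨min (1 / 2) (M * (ε / M) ^ s⁻¹), by positivity, fun f hf hf0 hf1 hsmall z hz => ?_⟩
  have hsub : ball (0 : ℂ) R ⊆ ball 0 r := ball_subset_ball hRr.le
  have hhalf : ‖f 0‖ < 1 / 2 := hsmall.trans_le (min_le_left _ _)
  have hpow : ‖f 0‖ / M < (ε / M) ^ s⁻¹ := by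
    rw [div_lt_iff₀' hMpos]; exact hsmall.trans_le (min_le_right _ _)
  have hzR : z ∈ ball (0 : ℂ) R := closedBall_subset_ball hρR hz
  have hfz := norm_le_mul_rpow_of_ne_zero (hf.mono hsub) (fun x hx => hf0 x (hsub hx))
    (fun x hx => (hK f hf hf0 hf1 hhalf.le x (ball_subset_closedBall hx)).trans (le_max_left _ _))
    (by linarith) hzR
  have hf00 : 0 < ‖f 0‖ := norm_pos_iff.2 (hf0 0 (mem_ball_self (hRpos.trans hRr)))
  have hzρ : ‖z‖ ≤ ρ := by simpa using hz
  calc ‖f z‖ ≤ M * (‖f 0‖ / M) ^ ((1 - (‖z‖ / R) ^ 2) / 4) := hfz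
    _ ≤ M * (‖f 0‖ / M) ^ s := by
        gcongr ?_ * ?_
        refine Real.rpow_le_rpow_of_exponent_ge (by positivity)
          ((div_le_one hMpos).2 (by linarith)) ?_
        rw [hs]
        gcongr
    _ < M * ((ε / M) ^ s⁻¹) ^ s := by gcongr
    _ = ε := by
        rw [← Real.rpow_mul (by positivity), inv_mul_cancel₀ hspos.ne', Real.rpow_one]
        field_simp

/-- A holomorphic motion is jointly continuous in the parameter and the space
variable, even though the definition only imposes regularity in the parameter. -/
theorem holomorphic_motion_jointly_continuous
    (r : ℝ) (hr : 0 < r) (E : Set ℂ) (h : ℂ → ℂ → ℂ)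
    (hmot : IsHolomorphicMotion r E h)
    (hthree : ∃ a ∈ E, ∃ b ∈ E, ∃ c ∈ E, a ≠ b ∧ b ≠ c ∧ a ≠ c) :
    ContinuousOn (fun p : ℂ × ℂ => h p.1 p.2) (ball (0:ℂ) r ×ˢ E) := by
  obtain ⟨hid, hinj, hhol⟩ := hmot
  rintro ⟨c₀, z₀⟩ ⟨hc₀, hz₀⟩
  simp only at hc₀ hz₀
  obtain ⟨b, hb, hbz⟩ : ∃ b ∈ E, b ≠ z₀ := by
    obtain ⟨a, ha, b, hb, -, -, hab, -⟩ := hthree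
    by_cases haz : a = z₀
    · exact ⟨b, hb, fun hbz => hab (haz.trans hbz.symm)⟩
    · exact ⟨a, ha, haz⟩
  have hden : ∀ c ∈ ball (0 : ℂ) r, h c b - h c z₀ ≠ 0 := fun c hc =>
    sub_ne_zero.2 fun heq => hbz (hinj c hc hb hz₀ heq)
  have hbz' : 0 < ‖b - z₀‖ := norm_pos_iff.2 (sub_ne_zero.2 hbz)
  rw [mem_ball_zero_iff] at hc₀
  obtain ⟨ρ, hcρ, hρr⟩ := exists_between hc₀
  have hρ : 0 ≤ ρ := (norm_nonneg _).trans hcρ.le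
  have hsub : closedBall (0 : ℂ) ρ ⊆ ball 0 r := closedBall_subset_ball hρr
  obtain ⟨B, hB⟩ := (isCompact_closedBall (0 : ℂ) ρ).exists_bound_of_continuousOn
    (((hhol b hb).sub (hhol z₀ hz₀)).continuousOn.mono hsub)
  have hB0 : 0 < B + 1 := by
    linarith [(norm_nonneg _).trans (hB 0 (mem_closedBall_self hρ))]
  rw [Metric.continuousWithinAt_iff]
  intro ε hε
  obtain ⟨δ, hδ, hsmall⟩ := exists_norm_lt_of_ne_zero_of_ne_one hρ hρr
    (show 0 < ε / 2 / (B + 1) by positivity)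
  have hcont : ContinuousAt (fun c => h c z₀) c₀ :=
    ((hhol z₀ hz₀).differentiableAt
      (isOpen_ball.mem_nhds (mem_ball_zero_iff.2 hc₀))).continuousAt
  obtain ⟨η, hη, hclose⟩ := Metric.continuousAt_iff.1 hcont (ε / 2) (half_pos hε)
  refine ⟨min (min η (ρ - ‖c₀‖)) (min (δ * ‖b - z₀‖) ‖b - z₀‖), ?_, ?_⟩
  · have : 0 < ρ - ‖c₀‖ := by linarith
    positivity
  rintro ⟨c, z⟩ ⟨hc, hz⟩ hdist
  simp only at hc hz
  simp only [Prod.dist_eq, max_lt_iff, lt_min_iff] at hdist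
  obtain ⟨⟨⟨hc1, -⟩, hc2, -⟩, ⟨-, hz1⟩, -, hz2⟩ := hdist
  have hcmem : c ∈ closedBall (0 : ℂ) ρ := by
    rw [mem_closedBall_zero_iff]
    rw [dist_eq_norm] at hc2
    linarith [norm_sub_norm_le c c₀]
  rw [dist_eq_norm] at hz1 hz2
  have hspace : dist (h c z) (h c z₀) < ε / 2 := by
    rcases eq_or_ne z z₀ with rfl | hzz
    · simpa using half_pos hε
    have hzb : z ≠ b := by
      rintro rfl
      exact lt_irrefl _ hz2
    have hq := hsmall (fun c => (h c z - h c z₀) / (h c b - h c z₀))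
      (((hhol z hz).sub (hhol z₀ hz₀)).div ((hhol b hb).sub (hhol z₀ hz₀)) hden)
      (fun x hx => div_ne_zero (sub_ne_zero.2 fun heq => hzz (hinj x hx hz hz₀ heq)) (hden x hx))
      (fun x hx heq => hzb (hinj x hx hz hb (by
        rw [div_eq_one_iff_eq (hden x hx)] at heq
        exact sub_left_injective heq)))
      (by
        simp only [hid z hz, hid z₀ hz₀, hid b hb]
        rwa [norm_div, div_lt_iff₀ hbz']) c hcmem
    have hdenpos : 0 < ‖h c b - h c z₀‖ := norm_pos_iff.2 (hden c hc)
    rw [norm_div, div_lt_iff₀ hdenpos] at hq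
    rw [dist_eq_norm]
    refine hq.trans_le ?_
    calc ε / 2 / (B + 1) * ‖h c b - h c z₀‖ ≤ ε / 2 / (B + 1) * (B + 1) := by
          gcongr
          exact (hB c hcmem).trans (by linarith)
      _ = ε / 2 := by field_simp
  calc dist (h c z) (h c₀ z₀) ≤ dist (h c z) (h c z₀) + dist (h c z₀) (h c₀ z₀) :=
        dist_triangle _ _ _
    _ < ε / 2 + ε / 2 := add_lt_add hspace (hclose hc1)
    _ = ε := add_halves ε
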